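/- arXiv:1806.08238 — 3 statements merged into one kernel-verified Lean document; each statement's English description precedes it below -/
import Mathlib

section
/- Let ω > 0, 0 < b < a, 0 ≤ p ≤ 1, 0 ≤ γ ≤ 1, and Θ = Θ_D(ω, b, γ) = (2/π)·((1 + e^{−πb/ω})/(1 + (b/ω)²))·((1 − γ)/(1 + γ·e^{−πb/ω})). Let H(iω) = (1 + iω/a)/(1 + iω/b) be the frequency response of the lag filter with zero at −a and pole at −b, and let G*(iω) = H(iω) + i(1 − p)·Θ·(H(iω) − b/a) be its reset describing function (here b/a is the direct feedthrough of the filter's state-space realization). Then, with k = (1 − p)·Θ·(1 − b/a) ≥ 0, the principal argument of G*(iω) minus the principal argument of H(iω) equals arctan( k / (1 + (ω/a)² + k·(ω/a)) ). -/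
open Real Complex

/-- For a nonnegative product `u * y`, arctangents subtract without leaving the principal branch. -/
theorem Real.arctan_sub_arctan {u y : ℝ} (h : 0 ≤ u * y) :
    Real.arctan u - Real.arctan y = Real.arctan ((u - y) / (1 + u * y)) := by
  rw [sub_eq_add_neg, ← Real.arctan_neg, Real.arctan_add (by linarith)]
  congr 1
  ring

theorem Complex.arg_eq_arctan_of_re_pos {z : ℂ} (hz : 0 < z.re) :
    z.arg = Real.arctan (z.im / z.re) := by
  have h := abs_lt.1 (Complex.abs_arg_lt_pi_div_two_iff.2 (Or.inl hz))
  rw [← Complex.tan_arg, Real.arctan_tan h.1 h.2]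

theorem Complex.arg_one_add_I_mul_div {u y : ℝ} (h : 0 ≤ u * y) :
    ((1 + Complex.I * (u : ℂ)) / (1 + Complex.I * (y : ℂ))).arg =
      Real.arctan u - Real.arctan y := by
  have hy : 0 < 1 + y * y := by nlinarith [mul_self_nonneg y]
  have hre : ((1 + Complex.I * (u : ℂ)) / (1 + Complex.I * (y : ℂ))).re =
      (1 + u * y) / (1 + y * y) := by
    simp [Complex.div_re, Complex.normSq_apply]
    ring
  have him : ((1 + Complex.I * (u : ℂ)) / (1 + Complex.I * (y : ℂ))).im =
      (u - y) / (1 + y * y) := by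
    simp [Complex.div_im, Complex.normSq_apply]
    ring
  rw [Complex.arg_eq_arctan_of_re_pos (by rw [hre]; positivity), hre, him,
    div_div_div_cancel_right₀ hy.ne', Real.arctan_sub_arctan h]

/-- The phase lead obtained by resetting the lag filter `(1 + s/a)/(1 + s/b)`
(zero at `−a`, pole at `−b`, feedthrough `b/a`) with partial-reset factor `γ`
and reset percentage `p` equals `arctan(k / (1 + (ω/a)² + k·(ω/a)))` with
`k = (1−p)·Θ·(1 − b/a) ≥ 0`. -/
theorem lag_reset_phase_lead (ω a b p γ : ℝ) (hω : 0 < ω) (hb : 0 < b) (hba : b < a)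
    (hp₀ : 0 ≤ p) (hp₁ : p ≤ 1) (hγ₀ : 0 ≤ γ) (hγ₁ : γ ≤ 1) :
    let Θ : ℝ := (2 / π) * ((1 + Real.exp (-(π * b / ω))) / (1 + (b / ω) ^ 2)) *
      ((1 - γ) / (1 + γ * Real.exp (-(π * b / ω))))
    let H : ℂ := (1 + Complex.I * (ω : ℂ) / (a : ℂ)) / (1 + Complex.I * (ω : ℂ) / (b : ℂ))
    let G : ℂ := H + Complex.I * (((1 - p) * Θ : ℝ) : ℂ) * (H - ((b / a : ℝ) : ℂ))
    let k : ℝ := (1 - p) * Θ * (1 - b / a)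
    0 ≤ k ∧
      G.arg - H.arg = Real.arctan (k / (1 + (ω / a) ^ 2 + k * (ω / a))) := by
  intro Θ H G k
  have ha : 0 < a := hb.trans hba
  have hΘ : 0 ≤ Θ := by
    have : 0 ≤ 1 - γ := sub_nonneg.2 hγ₁
    positivity
  have hk : 0 ≤ k :=
    mul_nonneg (mul_nonneg (sub_nonneg.2 hp₁) hΘ) (sub_nonneg.2 ((div_le_one ha).2 hba.le))
  refine ⟨hk, ?_⟩
  have hH : H = (1 + Complex.I * ((ω / a : ℝ) : ℂ)) / (1 + Complex.I * ((ω / b : ℝ) : ℂ)) := by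
    simp only [H, Complex.ofReal_div, mul_div_assoc]
  have hden : 1 + Complex.I * ((ω / b : ℝ) : ℂ) ≠ 0 := fun h => by
    simpa using congrArg Complex.re h
  have hfeed : H - ((b / a : ℝ) : ℂ) =
      ((1 - b / a : ℝ) : ℂ) / (1 + Complex.I * ((ω / b : ℝ) : ℂ)) := by
    have hab : ((b / a : ℝ) : ℂ) * ((ω / b : ℝ) : ℂ) = ((ω / a : ℝ) : ℂ) := by
      rw [← Complex.ofReal_mul]
      congr 1
      field_simp
    rw [hH, eq_div_iff hden, sub_mul, div_mul_cancel₀ _ hden, Complex.ofReal_sub,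
      Complex.ofReal_one]
    linear_combination -Complex.I * hab
  have hG : G = (1 + Complex.I * ((ω / a + k : ℝ) : ℂ)) / (1 + Complex.I * ((ω / b : ℝ) : ℂ)) := by
    have hk' : (k : ℂ) = (((1 - p) * Θ : ℝ) : ℂ) * ((1 - b / a : ℝ) : ℂ) :=
      Complex.ofReal_mul _ _
    simp only [G]
    rw [hfeed, hH, Complex.ofReal_add, hk']
    ring
  rw [hG, hH, Complex.arg_one_add_I_mul_div (by positivity),
    Complex.arg_one_add_I_mul_div (by positivity), sub_sub_sub_cancel_right,
    Real.arctan_sub_arctan (by positivity)]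
  congr 1
  ring
end

section
/- For every fixed ω > 0 and 0 ≤ γ < 1, the function b ↦ Θ_D(ω, b, γ) = (2/π)·((1 + e^{−πb/ω})/(1 + (b/ω)²))·((1 − γ)/(1 + γ·e^{−πb/ω})) is strictly decreasing on (0, ∞). Consequently, for any 0 ≤ p < 1, resetting a first-order filter with a lower corner frequency yields a strictly larger describing-function phase lead arctan((1 − p)·Θ_D(ω, b, γ)) at ω than resetting one with a higher corner frequency. -/
open Real

/-- For `0 ≤ c < 1`, the map `x ↦ (1 + x) / (1 + c * x)` is strictly increasing on
`(0, ∞)`. -/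
theorem one_add_div_one_add_mul_lt {c x y : ℝ} (hc₀ : 0 ≤ c) (hc₁ : c < 1) (hx : 0 < x)
    (hxy : x < y) : (1 + x) / (1 + c * x) < (1 + y) / (1 + c * y) := by
  have hy : 0 < y := hx.trans hxy
  rw [div_lt_div_iff₀ (by positivity) (by positivity)]
  nlinarith [mul_pos (sub_pos.2 hc₁) (sub_pos.2 hxy)]

/-- For fixed `ω > 0` and `0 ≤ γ < 1`, the correction factor `b ↦ Θ_D(ω, b, γ)` is
strictly decreasing on `(0, ∞)`; consequently resetting a first-order filter with a
lower corner frequency yields a strictly larger phase lead at `ω`. -/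
theorem thetaD_strictAntiOn_b (ω γ : ℝ) (hω : 0 < ω) (hγ₀ : 0 ≤ γ) (hγ₁ : γ < 1) :
    let f : ℝ → ℝ := fun b =>
      (2 / π) * ((1 + Real.exp (-(π * b / ω))) / (1 + (b / ω) ^ 2)) *
        ((1 - γ) / (1 + γ * Real.exp (-(π * b / ω))))
    StrictAntiOn f (Set.Ioi 0) ∧
      ∀ p : ℝ, 0 ≤ p → p < 1 → ∀ b₁ b₂ : ℝ, b₁ ∈ Set.Ioi (0 : ℝ) →
        b₂ ∈ Set.Ioi (0 : ℝ) → b₁ < b₂ →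
          Real.arctan ((1 - p) * f b₂) < Real.arctan ((1 - p) * f b₁) := by
  intro f
  have hf : StrictAntiOn f (Set.Ioi 0) := by
    intro b₁ h₁ b₂ h₂ h
    have h₁ : 0 < b₁ := h₁
    have hx : b₁ / ω < b₂ / ω := by gcongr
    have hx₁ : 0 < b₁ / ω := by positivity
    have hE : Real.exp (-(π * b₂ / ω)) < Real.exp (-(π * b₁ / ω)) := by gcongr
    have hE₁ := Real.exp_pos (-(π * b₁ / ω))
    have hE₂ := Real.exp_pos (-(π * b₂ / ω))
    have hγ : 0 < 1 - γ := sub_pos.2 hγ₁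
    have hquot := one_add_div_one_add_mul_lt hγ₀ hγ₁ hE₂ hE
    have key : (1 + Real.exp (-(π * b₂ / ω))) / (1 + γ * Real.exp (-(π * b₂ / ω))) /
          (1 + (b₂ / ω) ^ 2) <
        (1 + Real.exp (-(π * b₁ / ω))) / (1 + γ * Real.exp (-(π * b₁ / ω))) /
          (1 + (b₁ / ω) ^ 2) := by
      apply div_lt_div₀ hquot (by gcongr) (by positivity) (by positivity)
    have hc : 0 < 2 / π * (1 - γ) := by positivity
    have hmul := mul_lt_mul_of_pos_left key hc
    have hrw (b : ℝ) : f b = 2 / π * (1 - γ) *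
        ((1 + Real.exp (-(π * b / ω))) / (1 + γ * Real.exp (-(π * b / ω))) /
          (1 + (b / ω) ^ 2)) := by
      simp only [f, div_eq_mul_inv]
      ring
    rwa [hrw, hrw]
  refine ⟨hf, fun p _ hp b₁ b₂ h₁ h₂ h => ?_⟩
  exact Real.arctan_strictMono (mul_lt_mul_of_pos_left (hf h₁ h₂ h) (sub_pos.2 hp))
end

section
/- Let ω > 0, a > 0, b > 0, and let ν be a real number with 0 ≤ ν ≤ 2. Let z = (1 + iω/a)/(1 + iω/b) ∈ ℂ. Then the principal argument of the principal complex power z^ν equals ν·(arctan(ω/a) − arctan(ω/b)). -/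
open Real Complex

theorem Complex.arg_one_add_mul_I (t : ℝ) : (1 + (t : ℂ) * I).arg = Real.arctan t := by
  have hre : (0 : ℝ) ≤ (1 + (t : ℂ) * I).re := by simp
  rw [arg_of_re_nonneg hre, Real.arctan_eq_arcsin]
  simp [Complex.norm_eq_sqrt_sq_add_sq]

theorem Complex.one_add_mul_I_ne_zero (t : ℝ) : (1 + (t : ℂ) * I) ≠ 0 := fun h => by
  simpa using congrArg Complex.re h

theorem Complex.arg_cpow_ofReal {z : ℂ} (hz : z ≠ 0) {ν : ℝ} (h₁ : -π < ν * z.arg)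
    (h₂ : ν * z.arg ≤ π) : (z ^ (ν : ℂ)).arg = ν * z.arg := by
  have him : (log z * ν).im = ν * z.arg := by simp [log_im, mul_comm]
  rw [cpow_def_of_ne_zero hz, ← log_im, log_exp (him ▸ h₁) (him ▸ h₂), him]

/-- The principal argument of the fractional-order lead/lag element
`((1 + iω/a)/(1 + iω/b))^ν` equals `ν·(arctan(ω/a) − arctan(ω/b))`. -/
theorem crone_fractional_leadlag_arg (ω a b ν : ℝ) (hω : 0 < ω) (ha : 0 < a)
    (hb : 0 < b) (hν₀ : 0 ≤ ν) (hν₂ : ν ≤ 2) :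
    let z : ℂ := (1 + Complex.I * (ω : ℂ) / (a : ℂ)) / (1 + Complex.I * (ω : ℂ) / (b : ℂ))
    (z ^ (ν : ℂ)).arg = ν * (Real.arctan (ω / a) - Real.arctan (ω / b)) := by
  intro z
  have hz : z = (1 + ((ω / a : ℝ) : ℂ) * I) / (1 + ((ω / b : ℝ) : ℂ) * I) := by
    simp only [z]
    push_cast
    ring_nf
  have ha₀ : 0 < Real.arctan (ω / a) := Real.arctan_pos.mpr (by positivity)
  have hb₀ : 0 < Real.arctan (ω / b) := Real.arctan_pos.mpr (by positivity)
  have ha₁ := Real.arctan_lt_pi_div_two (ω / a)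
  have hb₁ := Real.arctan_lt_pi_div_two (ω / b)
  have hu := Complex.one_add_mul_I_ne_zero (ω / a)
  have hv := Complex.one_add_mul_I_ne_zero (ω / b)
  have him : (Complex.log (1 + ((ω / a : ℝ) : ℂ) * I) -
      Complex.log (1 + ((ω / b : ℝ) : ℂ) * I)).im =
      Real.arctan (ω / a) - Real.arctan (ω / b) := by
    rw [sub_im, log_im, log_im, arg_one_add_mul_I, arg_one_add_mul_I]
  have harg : z.arg = Real.arctan (ω / a) - Real.arctan (ω / b) := by
    have hlog := Complex.log_exp (by rw [him]; linarith) (by rw [him]; linarith)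
    rw [Complex.exp_sub, Complex.exp_log hu, Complex.exp_log hv] at hlog
    rw [hz, ← log_im, hlog, him]
  rw [← harg]
  refine arg_cpow_ofReal (hz ▸ div_ne_zero hu hv) ?_ ?_ <;> rw [harg] <;> nlinarith [Real.pi_pos]
end
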